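/- arXiv:2512.18975 — 9 statements merged into one kernel-verified Lean document; each statement's English description precedes it below -/
import Mathlib

section
/- Let n ≥ 5 and let d be a metric on V_n. Then d lies in the pair-cut cone PCUT_n if and only if for every pair of distinct elements i, j ∈ V_n the inequality s_i + s_j ≥ (n − 4)·d(i,j) + (2/(n − 2))·Tr(d) holds. -/
open Finset

/-- A metric on a finite set: zero on the diagonal, symmetric, positive off the
diagonal, and satisfying the triangle inequality. -/
def IsMetric {α : Type*} (d : α → α → ℝ) : Prop :=
  (∀ i, d i i = 0) ∧ (∀ i j, d i j = d j i) ∧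
  (∀ i j, i ≠ j → 0 < d i j) ∧ (∀ i j k, d i j ≤ d i k + d k j)

/-- The cut semimetric `δ_C`: equals 1 iff exactly one of `i, j` lies in `C`. -/
def cutSemimetric {α : Type*} [DecidableEq α] (C : Finset α) (i j : α) : ℝ :=
  if (i ∈ C ∧ j ∉ C) ∨ (j ∈ C ∧ i ∉ C) then 1 else 0

/-- Membership in the pair-cut cone `PCUT_n`: `d` is a nonnegative linear combination
of the cut semimetrics of 2-element cuts. -/
def InPCUT {n : ℕ} (d : Fin n → Fin n → ℝ) : Prop :=
  ∃ w : Finset (Fin n) → ℝ, (∀ P, 0 ≤ w P) ∧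
    ∀ i j, d i j = ∑ P ∈ Finset.powersetCard 2 (Finset.univ : Finset (Fin n)),
      w P * cutSemimetric P i j

/-- The trace `Tr(d) = ∑_{i<j} d(i,j)`. -/
def traceMetric {n : ℕ} (d : Fin n → Fin n → ℝ) : ℝ :=
  ∑ i : Fin n, ∑ j ∈ Finset.univ.filter (fun j => i < j), d i j

/-- The star trace `s_i = ∑_{j ≠ i} d(i,j)`. -/
def starTrace {n : ℕ} (d : Fin n → Fin n → ℝ) (i : Fin n) : ℝ :=
  ∑ j ∈ Finset.univ.erase i, d i j

theorem cutSemimetric_eq {α : Type*} [DecidableEq α] (P : Finset α) (i j : α) :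
    cutSemimetric P i j = (if i ∈ P then 1 else 0) + (if j ∈ P then 1 else 0)
      - 2 * (if i ∈ P ∧ j ∈ P then 1 else 0) := by
  unfold cutSemimetric
  by_cases hi : i ∈ P <;> by_cases hj : j ∈ P <;> (simp [hi, hj]; try norm_num)

theorem cutSemimetric_self {α : Type*} [DecidableEq α] (P : Finset α) (i : α) :
    cutSemimetric P i i = 0 := by
  simp [cutSemimetric]

section PairSums

variable {α : Type*} [Fintype α] [DecidableEq α]

/-- Summing over the pairs containing `i` is summing over the other element. -/
theorem sum_powersetCard_two_filter_mem (w : Finset α → ℝ) (i : α) :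
    ∑ P ∈ (powersetCard 2 univ).filter (i ∈ ·), w P = ∑ k ∈ univ.erase i, w {i, k} := by
  symm
  refine sum_bij (fun k _ => {i, k}) ?_ ?_ ?_ (fun _ _ => rfl)
  · intro k hk
    have hik : i ≠ k := (ne_of_mem_erase hk).symm
    simp [mem_powersetCard, card_pair hik]
  · intro a ha b hb hab
    have h : a ∈ ({i, b} : Finset α) := hab ▸ by simp
    simpa [ne_of_mem_erase ha] using h
  · intro P hP
    obtain ⟨hP, hi⟩ := mem_filter.1 hP
    obtain ⟨x, y, hxy, rfl⟩ := card_eq_two.1 (mem_powersetCard.1 hP).2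
    rcases mem_insert.1 hi with rfl | hi
    · exact ⟨y, by simp [hxy.symm], rfl⟩
    · obtain rfl := mem_singleton.1 hi
      exact ⟨x, by simp [hxy], pair_comm _ _⟩

/-- Two distinct elements lie together in exactly one pair. -/
theorem powersetCard_two_filter_mem_mem {i j : α} (hij : i ≠ j) :
    (powersetCard 2 (univ : Finset α)).filter (fun P => i ∈ P ∧ j ∈ P) = {{i, j}} := by
  ext P
  simp only [mem_filter, mem_powersetCard, subset_univ, true_and, mem_singleton]
  constructor
  · rintro ⟨hP, hi, hj⟩
    refine (eq_of_subset_of_card_le ?_ ?_).symm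
    · simp [insert_subset_iff, hi, hj]
    · rw [hP, card_pair hij]
  · rintro rfl
    simp [card_pair hij]

theorem sum_mul_cutSemimetric (w : Finset α → ℝ) {i j : α} (hij : i ≠ j) :
    ∑ P ∈ powersetCard 2 univ, w P * cutSemimetric P i j =
      ∑ k ∈ univ.erase i, w {i, k} + ∑ k ∈ univ.erase j, w {j, k} - 2 * w {i, j} := by
  rw [← sum_powersetCard_two_filter_mem, ← sum_powersetCard_two_filter_mem,
    ← sum_singleton w {i, j}, ← powersetCard_two_filter_mem_mem hij, sum_filter, sum_filter,
    sum_filter, mul_sum, ← sum_add_distrib, ← sum_sub_distrib]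
  refine sum_congr rfl fun P _ => ?_
  rw [cutSemimetric_eq]
  split_ifs <;> ring

end PairSums

section Traces

variable {n : ℕ} {d : Fin n → Fin n → ℝ}

theorem sum_starTrace (hsymm : ∀ i j, d i j = d j i) :
    ∑ i, starTrace d i = 2 * traceMetric d := by
  have hswap : traceMetric d = ∑ i : Fin n, ∑ j ∈ univ.filter (fun j => j < i), d i j := by
    unfold traceMetric
    rw [sum_comm' (t' := univ) (s' := fun j => univ.filter (fun i => i < j)) (by simp)]
    exact sum_congr rfl fun i _ => sum_congr rfl fun j _ => hsymm j i
  rw [two_mul]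
  nth_rewrite 2 [hswap]
  unfold traceMetric starTrace
  rw [← sum_add_distrib]
  refine sum_congr rfl fun i _ => ?_
  rw [← sum_union]
  · refine sum_congr ?_ fun _ _ => rfl
    ext j
    simp only [mem_erase, mem_univ, and_true, mem_union, mem_filter, true_and]
    exact ne_comm.trans ne_iff_lt_or_gt
  · exact disjoint_filter.2 fun j _ h => h.asymm

theorem sum_erase_const_add (i : Fin n) (c : ℝ) (f : Fin n → ℝ) :
    ∑ k ∈ univ.erase i, (c + f k) = ((n : ℝ) - 1) * c + (∑ k, f k - f i) := by
  have hn : 1 ≤ n := i.pos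
  rw [sum_add_distrib, sum_const, card_erase_of_mem (mem_univ i), card_univ, Fintype.card_fin,
    nsmul_eq_mul, Nat.cast_sub hn, Nat.cast_one, sum_erase_eq_sub (mem_univ i)]

theorem starTrace_of_eq_add_sub {r : Fin n → ℝ} {v : Fin n → Fin n → ℝ}
    (hr : ∀ i, ∑ k ∈ univ.erase i, v i k = r i)
    (h : ∀ i j, i ≠ j → d i j = r i + r j - 2 * v i j) (i : Fin n) :
    starTrace d i = ((n : ℝ) - 4) * r i + ∑ k, r k := by
  have hs : starTrace d i = ∑ k ∈ univ.erase i, (r i + r k) - 2 * ∑ k ∈ univ.erase i, v i k := by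
    rw [mul_sum, ← sum_sub_distrib]
    exact sum_congr rfl fun k hk => h i k (ne_of_mem_erase hk).symm
  rw [hs, hr, sum_erase_const_add]
  ring

end Traces

/-- The weight of the pair `P` in the expansion of `d` in pair cuts. -/
noncomputable def pairCutWeight {n : ℕ} (d : Fin n → Fin n → ℝ) (P : Finset (Fin n)) : ℝ :=
  if P.card = 2 then
    (∑ i ∈ P, starTrace d i - ((n : ℝ) - 4) * ((∑ i ∈ P, ∑ j ∈ P, d i j) / 2)
      - 2 / ((n : ℝ) - 2) * traceMetric d) / (2 * ((n : ℝ) - 4))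
  else 0

theorem pairCutWeight_pair {n : ℕ} {d : Fin n → Fin n → ℝ} (hzero : ∀ i, d i i = 0)
    (hsymm : ∀ i j, d i j = d j i) {i j : Fin n} (hij : i ≠ j) :
    pairCutWeight d {i, j} = (starTrace d i + starTrace d j - ((n : ℝ) - 4) * d i j
      - 2 / ((n : ℝ) - 2) * traceMetric d) / (2 * ((n : ℝ) - 4)) := by
  have hsum : (∑ a ∈ ({i, j} : Finset (Fin n)), ∑ b ∈ ({i, j} : Finset (Fin n)), d a b) / 2
      = d i j := by
    rw [sum_pair hij, sum_pair hij, sum_pair hij, hzero, hzero, hsymm j i]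
    ring
  rw [pairCutWeight, if_pos (card_pair hij), hsum, sum_pair hij]

theorem sum_pairCutWeight {n : ℕ} {d : Fin n → Fin n → ℝ} (hzero : ∀ i, d i i = 0)
    (hsymm : ∀ i j, d i j = d j i) (i : Fin n) :
    ∑ k ∈ univ.erase i, pairCutWeight d {i, k} =
      (2 * starTrace d i + 2 * traceMetric d
        - ((n : ℝ) - 1) * (2 / ((n : ℝ) - 2) * traceMetric d)) / (2 * ((n : ℝ) - 4)) := by
  have hs : ∑ k ∈ univ.erase i, pairCutWeight d {i, k} =
      (∑ k ∈ univ.erase i, ((starTrace d i - 2 / ((n : ℝ) - 2) * traceMetric d) + starTrace d k)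
        - ((n : ℝ) - 4) * starTrace d i) / (2 * ((n : ℝ) - 4)) := by
    rw [show ((n : ℝ) - 4) * starTrace d i = ∑ k ∈ univ.erase i, ((n : ℝ) - 4) * d i k from
      mul_sum _ _ _, ← sum_sub_distrib, sum_div]
    refine sum_congr rfl fun k hk => ?_
    rw [pairCutWeight_pair hzero hsymm (ne_of_mem_erase hk).symm]
    ring
  rw [hs, sum_erase_const_add, sum_starTrace hsymm]
  ring

/-- For `n ≥ 5`, a metric `d` on `V_n` lies in the pair-cut cone
`PCUT_n` iff `s_i + s_j ≥ (n-4)·d(i,j) + (2/(n-2))·Tr(d)` for all pairs `i ≠ j`. -/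
theorem pcut_membership_iff (n : ℕ) (hn : 5 ≤ n) (d : Fin n → Fin n → ℝ)
    (hd : IsMetric d) :
    InPCUT d ↔ ∀ i j : Fin n, i ≠ j →
      starTrace d i + starTrace d j ≥
        ((n : ℝ) - 4) * d i j + (2 / ((n : ℝ) - 2)) * traceMetric d := by
  obtain ⟨hzero, hsymm, -, -⟩ := hd
  have hn' : (5 : ℝ) ≤ n := by exact_mod_cast hn
  have h2 : (n : ℝ) - 2 ≠ 0 := by linarith
  have h4 : (n : ℝ) - 4 ≠ 0 := by linarith
  constructor
  · rintro ⟨w, hw, hdw⟩ i j hij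
    set r : Fin n → ℝ := fun i => ∑ k ∈ univ.erase i, w {i, k} with hr
    have hd' : ∀ i j, i ≠ j → d i j = r i + r j - 2 * w {i, j} := fun i j hij =>
      (hdw i j).trans (sum_mul_cutSemimetric w hij)
    have hs := starTrace_of_eq_add_sub (v := fun i j => w {i, j}) (fun _ => rfl) hd'
    have htr : traceMetric d = ((n : ℝ) - 2) * ∑ k, r k := by
      have h := sum_starTrace hsymm
      simp only [hs, sum_add_distrib, ← mul_sum, sum_const, card_univ, Fintype.card_fin,
        nsmul_eq_mul] at h
      linarith
    have hc : 2 / ((n : ℝ) - 2) * traceMetric d = 2 * ∑ k, r k := by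
      rw [htr]
      field_simp
    rw [hc, hs, hs, hd' i j hij]
    nlinarith [mul_nonneg (show (0 : ℝ) ≤ n - 4 by linarith) (hw {i, j})]
  · intro h
    refine ⟨pairCutWeight d, fun P => ?_, fun i j => ?_⟩
    · by_cases hP : P.card = 2
      · obtain ⟨i, j, hij, rfl⟩ := card_eq_two.1 hP
        rw [pairCutWeight_pair hzero hsymm hij]
        exact div_nonneg (by linarith [h i j hij]) (by linarith)
      · rw [pairCutWeight, if_neg hP]
    · rcases eq_or_ne i j with rfl | hij
      · simp [cutSemimetric_self, hzero]
      · rw [sum_mul_cutSemimetric _ hij, sum_pairCutWeight hzero hsymm,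
          sum_pairCutWeight hzero hsymm, pairCutWeight_pair hzero hsymm hij]
        field_simp
        ring
end

section
/- Let n ≥ 5 and let d be a metric on V_n. If d lies in the pair-cut cone PCUT_n, then (n − 2)·s_i ≥ Tr(d) for every i ∈ V_n. -/
open Finset

/-- For a symmetric function vanishing on the diagonal, the sum over all ordered pairs
is twice the trace. -/
lemma sum_sum_eq_two_mul_traceMetric {n : ℕ} {d : Fin n → Fin n → ℝ}
    (h0 : ∀ i, d i i = 0) (hsymm : ∀ i j, d i j = d j i) :
    ∑ i, ∑ j, d i j = 2 * traceMetric d := by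
  have htrace : traceMetric d = ∑ i, ∑ j, if i < j then d i j else 0 := by
    simp only [traceMetric, sum_filter]
  have hswap : traceMetric d = ∑ i, ∑ j, if j < i then d i j else 0 := by
    rw [htrace, sum_comm]
    simp only [hsymm]
  rw [two_mul]
  nth_rewrite 1 [htrace]
  rw [hswap]
  simp only [← sum_add_distrib]
  refine sum_congr rfl fun i _ => sum_congr rfl fun j _ => ?_
  rcases lt_trichotomy i j with h | rfl | h
  · simp [h, h.not_gt]
  · simp [h0]
  · simp [h, h.not_gt]

lemma starTrace_eq_sum {n : ℕ} {d : Fin n → Fin n → ℝ} (h0 : ∀ i, d i i = 0) (i : Fin n) :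
    starTrace d i = ∑ j, d i j :=
  sum_erase _ (h0 i)

lemma sum_cutSemimetric {α : Type*} [Fintype α] [DecidableEq α] (C : Finset α) (i : α) :
    ∑ j, cutSemimetric C i j =
      if i ∈ C then (Fintype.card α : ℝ) - #C else (#C : ℝ) := by
  have hcompl : (#Cᶜ : ℝ) = (Fintype.card α : ℝ) - #C := by
    rw [card_compl, Nat.cast_sub (card_le_univ C)]
  by_cases hi : i ∈ C
  · have hcut (j : α) : cutSemimetric C i j = if j ∈ Cᶜ then 1 else 0 := by
      simp [cutSemimetric, hi]
    simp only [hcut, hi, if_true, ← hcompl, sum_boole, filter_univ_mem]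
  · simp [cutSemimetric, hi]

lemma sum_sum_cutSemimetric {α : Type*} [Fintype α] [DecidableEq α] (C : Finset α) :
    ∑ i, ∑ j, cutSemimetric C i j = 2 * (#C * ((Fintype.card α : ℝ) - #C)) := by
  have hcompl : (#Cᶜ : ℝ) = (Fintype.card α : ℝ) - #C := by
    rw [card_compl, Nat.cast_sub (card_le_univ C)]
  simp_rw [sum_cutSemimetric]
  rw [← sum_add_sum_compl C, sum_congr rfl fun i hi => if_pos hi,
    sum_congr (s₁ := Cᶜ) rfl fun i hi => if_neg (mem_compl.mp hi)]
  simp only [sum_const, nsmul_eq_mul, hcompl]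
  ring

/-- For `n ≥ 5`, if a metric `d` on `V_n` lies in the pair-cut cone
`PCUT_n`, then `(n-2)·s_i ≥ Tr(d)` for every vertex `i`. -/
theorem pcut_starTrace_lower_bound (n : ℕ) (hn : 5 ≤ n) (d : Fin n → Fin n → ℝ)
    (hd : IsMetric d) (hpcut : InPCUT d) :
    ∀ i : Fin n, ((n : ℝ) - 2) * starTrace d i ≥ traceMetric d := by
  obtain ⟨h0, hsymm, -, -⟩ := hd
  obtain ⟨w, hw, hdw⟩ := hpcut
  intro i
  have hn' : (5 : ℝ) ≤ n := by exact_mod_cast hn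
  have hstar : starTrace d i = ∑ P ∈ powersetCard 2 univ,
      w P * ∑ j, cutSemimetric P i j := by
    simp only [starTrace_eq_sum h0, hdw, mul_sum]
    exact sum_comm
  have htrace : 2 * traceMetric d = ∑ P ∈ powersetCard 2 univ,
      w P * ∑ i, ∑ j, cutSemimetric P i j := by
    rw [← sum_sum_eq_two_mul_traceMetric h0 hsymm]
    simp only [hdw, mul_sum]
    rw [sum_congr rfl fun i _ => sum_comm]
    exact sum_comm
  suffices 2 * traceMetric d ≤ 2 * (((n : ℝ) - 2) * starTrace d i) by linarith
  rw [htrace, hstar, mul_sum, mul_sum]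
  refine sum_le_sum fun P hP => ?_
  rw [sum_sum_cutSemimetric, sum_cutSemimetric, (mem_powersetCard.mp hP).2, Fintype.card_fin]
  have hle : (2 : ℝ) ≤ if i ∈ P then (n : ℝ) - (2 : ℕ) else (2 : ℕ) := by
    split_ifs <;> push_cast <;> linarith
  have hmul := mul_le_mul_of_nonneg_left hle
    (mul_nonneg (hw P) (by linarith : (0 : ℝ) ≤ (n : ℝ) - 2))
  push_cast at hmul ⊢
  linarith
end

section
/- Let n ≥ 4 and consider the star graph S(n) on the (n+1)-element vertex set W = {0, 1, …, n}. Then no SIG-metric d for S(n) lies in the pair-cut cone PCUT_{n+1} of metrics on W. In particular, for every N ≥ 5 there is a connected simple graph on N vertices none of whose SIG-metrics lies in PCUT_N. -/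
open Finset

/-- The star graph `S(n)` on vertex set `{0, 1, …, n}`: edges are exactly `{0, i}`
for `i = 1, …, n` (vertex `0` is the center). -/
def starGraph (n : ℕ) : SimpleGraph (Fin (n + 1)) :=
  SimpleGraph.fromRel (fun i _ => i = 0)

/-- The radius of influence `r_i = min_{j ≠ i} d(i,j)`. -/
noncomputable def sigRadius {α : Type*} (d : α → α → ℝ) (i : α) : ℝ :=
  sInf {x | ∃ j, j ≠ i ∧ x = d i j}

/-- `d` is a `SIG`-metric for the graph `G`: for distinct vertices `i, j` we have
`d(i,j) < r_i + r_j` when `i ~ j`, and `d(i,j) ≥ r_i + r_j` otherwise. -/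
def IsSIGMetric {α : Type*} (G : SimpleGraph α) (d : α → α → ℝ) : Prop :=
  ∀ i j, i ≠ j →
    (G.Adj i j → d i j < sigRadius d i + sigRadius d j) ∧
    (¬ G.Adj i j → sigRadius d i + sigRadius d j ≤ d i j)

theorem starGraph_adj_iff {n : ℕ} {i j : Fin (n + 1)} :
    (starGraph n).Adj i j ↔ i ≠ j ∧ (i = 0 ∨ j = 0) :=
  SimpleGraph.fromRel_adj _ i j

theorem starGraph_connected (n : ℕ) : (starGraph n).Connected := by
  rw [SimpleGraph.connected_iff_exists_forall_reachable]
  refine ⟨0, fun i => ?_⟩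
  by_cases hi : 0 = i
  · exact hi ▸ SimpleGraph.Reachable.refl 0
  · exact (starGraph_adj_iff.2 ⟨hi, Or.inl rfl⟩).reachable

/-- On a finite type with at least two points the radius of influence is attained. -/
theorem exists_sigRadius_eq {α : Type*} [Finite α] [Nontrivial α] (d : α → α → ℝ) (i : α) :
    ∃ j, j ≠ i ∧ sigRadius d i = d i j := by
  obtain ⟨k, hk⟩ := exists_ne i
  have hne : {x | ∃ j, j ≠ i ∧ x = d i j}.Nonempty := ⟨d i k, k, hk, rfl⟩
  have hfin : {x | ∃ j, j ≠ i ∧ x = d i j}.Finite :=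
    (Set.finite_range (d i)).subset (by rintro _ ⟨j, -, rfl⟩; exact ⟨j, rfl⟩)
  exact hne.csInf_mem hfin

theorem sigRadius_pos {α : Type*} [Finite α] [Nontrivial α] {d : α → α → ℝ} (hd : IsMetric d)
    (i : α) : 0 < sigRadius d i := by
  obtain ⟨j, hj, h⟩ := exists_sigRadius_eq d i
  exact h ▸ hd.2.2.1 i j hj.symm

/-- A vertex of a `SIG`-metric attains its radius of influence at a neighbour. -/
theorem IsSIGMetric.exists_adj_sigRadius_eq {α : Type*} [Finite α] [Nontrivial α]
    {G : SimpleGraph α} {d : α → α → ℝ} (hd : IsMetric d) (hG : IsSIGMetric G d) (i : α) :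
    ∃ j, G.Adj i j ∧ sigRadius d i = d i j := by
  obtain ⟨j, hj, h⟩ := exists_sigRadius_eq d i
  refine ⟨j, ?_, h⟩
  by_contra hadj
  linarith [(hG i j hj.symm).2 hadj, sigRadius_pos hd j]

/-- In a `SIG`-metric for the star, distances between leaves are realised through the center. -/
theorem IsSIGMetric.add_le_of_starGraph {n : ℕ} {d : Fin (n + 1) → Fin (n + 1) → ℝ}
    (hd : IsMetric d) (hG : IsSIGMetric (starGraph n) d) {i j : Fin (n + 1)} (hi : i ≠ 0)
    (hj : j ≠ 0) (hij : i ≠ j) : d 0 i + d 0 j ≤ d i j := by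
  have : Nontrivial (Fin (n + 1)) := ⟨i, 0, hi⟩
  have radius_eq : ∀ k : Fin (n + 1), k ≠ 0 → sigRadius d k = d 0 k := by
    intro k hk
    obtain ⟨l, hadj, h⟩ := hG.exists_adj_sigRadius_eq hd k
    obtain rfl : l = 0 := (starGraph_adj_iff.1 hadj).2.resolve_left hk
    rw [h, hd.2.1]
  have h := (hG i j hij).2 fun hadj => (starGraph_adj_iff.1 hadj).2.elim hi hj
  rwa [radius_eq i hi, radius_eq j hj] at h

theorem cutSemimetric_triangle {α : Type*} [DecidableEq α] (C : Finset α) (i j k : α) :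
    cutSemimetric C i j ≤ cutSemimetric C k i + cutSemimetric C k j := by
  unfold cutSemimetric
  by_cases hi : i ∈ C <;> by_cases hj : j ∈ C <;> by_cases hk : k ∈ C <;> simp [hi, hj, hk]

/-- A pair cut of at least four points separates a given point from two others which it does
not separate from each other. -/
theorem exists_pair_cutSemimetric {α : Type*} [Fintype α] [DecidableEq α]
    (hα : 4 ≤ Fintype.card α) {P : Finset α} (hP : #P = 2) (k : α) :
    ∃ i j, i ≠ k ∧ j ≠ k ∧ i ≠ j ∧ cutSemimetric P k i = 1 ∧ cutSemimetric P k j = 1 ∧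
      cutSemimetric P i j = 0 := by
  by_cases hk : k ∈ P
  · have hc : 1 < #Pᶜ := by rw [card_compl]; omega
    obtain ⟨i, hi, j, hj, hij⟩ := one_lt_card.1 hc
    rw [mem_compl] at hi hj
    exact ⟨i, j, fun h => hi (h ▸ hk), fun h => hj (h ▸ hk), hij, by simp [cutSemimetric, *]⟩
  · obtain ⟨i, hi, j, hj, hij⟩ := one_lt_card.1 (by omega : 1 < #P)
    exact ⟨i, j, fun h => hk (h ▸ hi), fun h => hk (h ▸ hj), hij, by simp [cutSemimetric, *]⟩

theorem IsSIGMetric.not_inPCUT_of_starGraph {n : ℕ} (hn : 3 ≤ n)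
    {d : Fin (n + 1) → Fin (n + 1) → ℝ} (hd : IsMetric d)
    (hG : IsSIGMetric (starGraph n) d) : ¬ InPCUT d := by
  rintro ⟨w, hw, hdw⟩
  have weight_eq_zero : ∀ P ∈ powersetCard 2 (univ : Finset (Fin (n + 1))), w P = 0 := by
    intro P hP
    obtain ⟨i, j, hi, hj, hij, h0i, h0j, hPij⟩ :=
      exists_pair_cutSemimetric (by simpa using hn) (mem_powersetCard.1 hP).2 (0 : Fin (n + 1))
    have hle := hG.add_le_of_starGraph hd hi hj hij
    rw [hdw 0 i, hdw 0 j, hdw i j, ← sum_add_distrib, ← sub_nonpos, ← sum_sub_distrib] at hle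
    have hterm : ∀ Q ∈ powersetCard 2 (univ : Finset (Fin (n + 1))),
        0 ≤ w Q * cutSemimetric Q 0 i + w Q * cutSemimetric Q 0 j - w Q * cutSemimetric Q i j := by
      intro Q _
      rw [← mul_add, ← mul_sub]
      exact mul_nonneg (hw Q) (sub_nonneg.2 (cutSemimetric_triangle Q i j 0))
    have hzero := (single_le_sum hterm hP).trans hle
    rw [h0i, h0j, hPij] at hzero
    linarith [hw P]
  have h01 : (0 : Fin (n + 1)) ≠ Fin.last n := by
    simp only [ne_eq, Fin.ext_iff, Fin.val_zero, Fin.val_last]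
    omega
  have hpos := hd.2.2.1 _ _ h01
  rw [hdw, sum_eq_zero fun P hP => by rw [weight_eq_zero P hP, zero_mul]] at hpos
  exact hpos.false

/-- For `n ≥ 4`, no `SIG`-metric for the star graph `S(n)` (which has
`n + 1` vertices) lies in the pair-cut cone `PCUT_{n+1}`.  In particular, for every
`N ≥ 5` there is a connected simple graph on `N` vertices none of whose `SIG`-metrics
lies in `PCUT_N`. -/
theorem star_graph_no_sig_metric_in_pcut :
    (∀ n : ℕ, 4 ≤ n → ∀ d : Fin (n + 1) → Fin (n + 1) → ℝ, IsMetric d →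
      IsSIGMetric (starGraph n) d → ¬ InPCUT d) ∧
    (∀ N : ℕ, 5 ≤ N → ∃ G : SimpleGraph (Fin N), G.Connected ∧
      ∀ d : Fin N → Fin N → ℝ, IsMetric d → IsSIGMetric G d → ¬ InPCUT d) := by
  refine ⟨fun n hn d hd hG => hG.not_inPCUT_of_starGraph (by omega) hd, fun N hN => ?_⟩
  obtain ⟨n, rfl⟩ : ∃ n, N = n + 1 := ⟨N - 1, by omega⟩
  exact ⟨starGraph n, starGraph_connected n, fun d hd hG =>
    hG.not_inPCUT_of_starGraph (by omega) hd⟩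
end

section
/- For n ≥ 3, the characteristic polynomial of the square cut-matrix S_sq equals (X − (2n − 4)) · (X − (n − 4))^{n−1} · (X + 2)^{n(n−3)/2}. Equivalently, the eigenvalues of S_sq are 2n − 4 with multiplicity 1, n − 4 with multiplicity n − 1, and −2 with multiplicity n(n−3)/2. -/
open Finset Matrix Polynomial

/-- The 2-element subsets of `V_n = Fin n`; there are `C(n,2)` of them. -/
abbrev Pairs (n : ℕ) := {P : Finset (Fin n) // P.card = 2}

/-- The square cut-matrix `S_sq`: rows and columns indexed by 2-element subsets of
`V_n`, with entry 1 in row `P`, column `Q` iff `|P ∩ Q| = 1`.  It is the adjacency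
matrix of the line graph of the complete graph `K_n`. -/
def sqCutMatrix (n : ℕ) : Matrix (Pairs n) (Pairs n) ℝ :=
  Matrix.of fun P Q => if (P.1 ∩ Q.1).card = 1 then 1 else 0

/-- The incidence matrix of the complete graph `K_n`, with rows indexed by edges. -/
def pairIncidence (n : ℕ) : Matrix (Pairs n) (Fin n) ℝ :=
  Matrix.of fun P i => if i ∈ P.1 then 1 else 0

lemma sqCutMatrix_eq_mul_transpose_sub (n : ℕ) :
    sqCutMatrix n = pairIncidence n * (pairIncidence n)ᵀ - scalar (Pairs n) (2 : ℝ) := by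
  ext P Q
  have hmul : (pairIncidence n * (pairIncidence n)ᵀ) P Q = ((P.1 ∩ Q.1).card : ℝ) := by
    simp [Matrix.mul_apply, pairIncidence, ← ite_and, Finset.inter_comm,
      Finset.filter_and]
  rw [Matrix.sub_apply, hmul]
  by_cases h : P = Q
  · subst h
    simp [sqCutMatrix, P.2]
  · have hlt : (P.1 ∩ Q.1).card < 2 := by
      by_contra! hle
      have hP := Finset.eq_of_subset_of_card_le (Finset.inter_subset_left (s₁ := P.1) (s₂ := Q.1))
        (P.2.trans_le hle)
      have hQ := Finset.eq_of_subset_of_card_le (Finset.inter_subset_right (s₁ := P.1) (s₂ := Q.1))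
        (Q.2.trans_le hle)
      exact h (Subtype.ext (hP.symm.trans hQ))
    interval_cases hc : (P.1 ∩ Q.1).card <;> simp [sqCutMatrix, hc, h]

lemma sum_pairIncidence_row {n : ℕ} (P : Pairs n) : ∑ j, pairIncidence n P j = 2 := by
  simp [pairIncidence, P.2]

lemma transpose_mul_pairIncidence_of_ne {n : ℕ} {i j : Fin n} (hij : i ≠ j) :
    ((pairIncidence n)ᵀ * pairIncidence n) i j = 1 := by
  rw [Matrix.mul_apply, Finset.sum_eq_single ⟨{i, j}, Finset.card_pair hij⟩]
  · simp [pairIncidence]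
  · intro P _ hP
    by_contra hne
    have hmem : i ∈ P.1 ∧ j ∈ P.1 := by
      constructor <;> by_contra hm <;> simp [pairIncidence, hm] at hne
    refine hP (Subtype.ext (Finset.eq_of_subset_of_card_le ?_ ?_).symm)
    · simp [Finset.insert_subset_iff, hmem]
    · rw [P.2, Finset.card_pair hij]
  · simp

lemma transpose_mul_pairIncidence_diag {n : ℕ} (i : Fin n) :
    ((pairIncidence n)ᵀ * pairIncidence n) i i = (n : ℝ) - 1 := by
  set M := (pairIncidence n)ᵀ * pairIncidence n with hM
  have hdiag : M i i = ∑ P, pairIncidence n P i := by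
    simp [hM, Matrix.mul_apply, pairIncidence, ← ite_and]
  have hrow : ∑ j, M i j = 2 * M i i := by
    rw [hdiag]
    simp_rw [hM, Matrix.mul_apply]
    rw [Finset.sum_comm, Finset.mul_sum]
    refine Finset.sum_congr rfl fun P _ => ?_
    rw [← Finset.mul_sum, sum_pairIncidence_row, Matrix.transpose_apply, mul_comm]
  have hoff : ∑ j ∈ univ.erase i, M i j = (n : ℝ) - 1 := by
    rw [Finset.sum_congr rfl fun j hj =>
      transpose_mul_pairIncidence_of_ne (Finset.ne_of_mem_erase hj).symm]
    simp [Nat.cast_sub (Nat.one_le_of_lt i.pos)]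
  rw [← Finset.add_sum_erase _ _ (Finset.mem_univ i), hoff] at hrow
  linarith

lemma transpose_mul_pairIncidence (n : ℕ) :
    (pairIncidence n)ᵀ * pairIncidence n =
      vecMulVec 1 1 - scalar (Fin n) (2 - n : ℝ) := by
  ext i j
  rcases eq_or_ne i j with rfl | hij
  · rw [transpose_mul_pairIncidence_diag]
    simp
    ring
  · rw [transpose_mul_pairIncidence_of_ne hij]
    simp [hij]

lemma choose_two_sub_self (n : ℕ) : n.choose 2 - n = n * (n - 3) / 2 := by
  rw [Nat.choose_two_right]
  rcases lt_or_ge n 3 with hn | hn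
  · interval_cases n <;> rfl
  · obtain ⟨k, rfl⟩ := Nat.exists_eq_add_of_le' hn
    have h : (k + 3) * (k + 3 - 1) = (k + 3) * (k + 3 - 3) + 2 * (k + 3) := by
      simp only [Nat.add_sub_cancel, show k + 3 - 1 = k + 2 by omega]
      ring
    omega

/-- For `n ≥ 3`, the characteristic polynomial of the square
cut-matrix is `(X − (2n−4))·(X − (n−4))^{n−1}·(X + 2)^{n(n−3)/2}`; i.e. its
eigenvalues are `2n−4` (multiplicity 1), `n−4` (multiplicity `n−1`) and `−2`
(multiplicity `n(n−3)/2`). -/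
theorem sqCutMatrix_charpoly (n : ℕ) (hn : 3 ≤ n) :
    (sqCutMatrix n).charpoly =
      (X - C ((2 * n : ℝ) - 4)) * (X - C ((n : ℝ) - 4)) ^ (n - 1) *
        (X + C 2) ^ (n * (n - 3) / 2) := by
  have hcard : Fintype.card (Pairs n) = n.choose 2 := by
    simp [Fintype.card_subtype, Finset.univ_filter_card_eq]
  have hle : n ≤ n.choose 2 := by
    rw [Nat.choose_two_right, Nat.le_div_iff_mul_le two_pos]
    exact Nat.mul_le_mul_left n (by omega)
  rw [sqCutMatrix_eq_mul_transpose_sub, charpoly_sub_scalar,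
    charpoly_mul_comm_of_le _ _ (by simpa [hcard] using hle), transpose_mul_pairIncidence,
    charpoly_sub_scalar, charpoly_vecMulVec, hcard, Fintype.card_fin, choose_two_sub_self]
  obtain ⟨m, rfl⟩ := Nat.exists_eq_add_of_le' (show 1 ≤ n by omega)
  simp [pow_succ, smul_eq_C_mul, map_ofNat C]
  ring
end

section
/- For n ≥ 5, the square cut-matrix S_sq is invertible. -/
open Finset Matrix

/-- Pairs containing `i` correspond to the elements `k ≠ i`. -/
theorem sum_pairs_mem_eq_sum_erase {n : ℕ} (i : Fin n) (f : Finset (Fin n) → ℝ) :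
    ∑ P : Pairs n, (if i ∈ P.1 then f P.1 else 0) = ∑ k ∈ univ.erase i, f {i, k} := by
  rw [← Finset.sum_filter]
  symm
  refine Finset.sum_bij
    (fun k hk => (⟨{i, k}, Finset.card_pair (Finset.ne_of_mem_erase hk).symm⟩ : Pairs n))
    (by simp) ?_ ?_ (fun _ _ => rfl)
  · intro a ha b hb h
    have hab : ({i, a} : Finset (Fin n)) = {i, b} := congrArg Subtype.val h
    have hmem : a ∈ ({i, b} : Finset (Fin n)) := by simp [← hab]
    simpa [Finset.ne_of_mem_erase ha] using hmem
  · rintro ⟨P, hP⟩ h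
    obtain ⟨a, b, hab, rfl⟩ := Finset.card_eq_two.mp hP
    simp only [mem_filter, mem_univ, true_and, mem_insert, mem_singleton] at h
    rcases h with rfl | rfl
    · exact ⟨b, by simp [hab.symm], rfl⟩
    · exact ⟨a, by simp [hab], Subtype.ext (Finset.pair_comm _ _)⟩

/-- The number of common elements of two pairs, in terms of the cut-matrix. -/
theorem sum_mem_pair_eq_sqCutMatrix_add {n : ℕ} (P Q : Pairs n) :
    (∑ k ∈ P.1, if k ∈ Q.1 then (1 : ℝ) else 0) =
      sqCutMatrix n P Q + if P = Q then 2 else 0 := by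
  rw [Finset.sum_boole, Finset.filter_mem_eq_inter]
  by_cases hPQ : P = Q
  · subst hPQ
    simp [sqCutMatrix, P.2]
  · have hle : (P.1 ∩ Q.1).card ≤ 2 := (Finset.card_le_card inter_subset_left).trans P.2.le
    have hne : (P.1 ∩ Q.1).card ≠ 2 := fun h => hPQ <| Subtype.ext <| by
      have h₁ := Finset.eq_of_subset_of_card_le (inter_subset_left (s₁ := P.1) (s₂ := Q.1))
        (by rw [h, P.2])
      have h₂ := Finset.eq_of_subset_of_card_le (inter_subset_right (s₁ := P.1) (s₂ := Q.1))
        (by rw [h, Q.2])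
      exact h₁.symm.trans h₂
    have hcases : (P.1 ∩ Q.1).card = 0 ∨ (P.1 ∩ Q.1).card = 1 := by omega
    rcases hcases with h | h <;> simp [sqCutMatrix, hPQ, h]

/-- In terms of the vertex sums of `v`, the cut-matrix acts on `v` as follows. -/
theorem sqCutMatrix_mulVec_add {n : ℕ} (v : Pairs n → ℝ) (P : Pairs n) :
    (sqCutMatrix n *ᵥ v) P + 2 * v P =
      ∑ k ∈ P.1, ∑ Q : Pairs n, if k ∈ Q.1 then v Q else 0 := by
  rw [Finset.sum_comm]
  have h : ∀ Q : Pairs n, (∑ k ∈ P.1, if k ∈ Q.1 then v Q else 0) =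
      sqCutMatrix n P Q * v Q + if P = Q then 2 * v Q else 0 := fun Q => by
    have := congrArg (· * v Q) (sum_mem_pair_eq_sqCutMatrix_add P Q)
    simpa [Finset.sum_mul, add_mul, ite_mul] using this
  simp [h, Finset.sum_add_distrib, Matrix.mulVec, dotProduct]

/-- For `n ≥ 5`, the square cut-matrix `S_sq` is invertible. -/
theorem sqCutMatrix_isUnit (n : ℕ) (hn : 5 ≤ n) : IsUnit (sqCutMatrix n) := by
  rw [← Matrix.mulVec_injective_iff_isUnit]
  refine (injective_iff_map_eq_zero (sqCutMatrix n).mulVecLin).mpr fun v hv => ?_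
  rw [Matrix.mulVecLin_apply] at hv
  set d : Fin n → ℝ := fun k => ∑ Q : Pairs n, if k ∈ Q.1 then v Q else 0 with hd
  have hvd : ∀ P : Pairs n, 2 * v P = ∑ k ∈ P.1, d k := fun P => by
    simpa [hv] using sqCutMatrix_mulVec_add v P
  have hn' : (5 : ℝ) ≤ n := by exact_mod_cast hn
  have hrow : ∀ i, (n - 4 : ℝ) * d i = -∑ k, d k := fun i => by
    have h : 2 * d i = ∑ k ∈ univ.erase i, (d i + d k) := by
      calc 2 * d i = ∑ P : Pairs n, if i ∈ P.1 then ∑ k ∈ P.1, d k else 0 := by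
            simp only [hd, Finset.mul_sum, mul_ite, mul_zero]
            exact Finset.sum_congr rfl fun P _ => by rw [hvd P]
        _ = ∑ k ∈ univ.erase i, ∑ j ∈ {i, k}, d j :=
            sum_pairs_mem_eq_sum_erase i fun P => ∑ k ∈ P, d k
        _ = ∑ k ∈ univ.erase i, (d i + d k) := Finset.sum_congr rfl fun k hk =>
            Finset.sum_pair (Finset.ne_of_mem_erase hk).symm
    have hsum := Finset.add_sum_erase univ (fun k => d i + d k) (mem_univ i)
    simp only [← h, Finset.sum_add_distrib, Finset.sum_const, card_univ, Fintype.card_fin,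
      nsmul_eq_mul] at hsum
    linarith
  have htotal : ∑ k, d k = 0 := by
    have h := Finset.sum_congr (rfl : (univ : Finset (Fin n)) = univ) fun i _ => hrow i
    rw [← Finset.mul_sum, Finset.sum_const, card_univ, Fintype.card_fin, nsmul_eq_mul] at h
    have h' : (2 * n - 4 : ℝ) * ∑ k, d k = 0 := by linarith
    exact (mul_eq_zero.mp h').resolve_left (by linarith)
  have hd0 : ∀ i, d i = 0 := fun i => by
    have h := hrow i
    rw [htotal, neg_zero] at h
    exact (mul_eq_zero.mp h).resolve_left (by linarith)
  funext P
  have h := hvd P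
  simp only [hd0, Finset.sum_const_zero] at h
  simpa using h
end

section
/- For n ≥ 3 and m = C(n,2), the full cut-matrix S satisfies S·Sᵀ = 2^{n−2}·(I_m + J_m), where I_m is the m × m identity matrix and J_m the m × m matrix all of whose entries equal 1. -/
open Finset Matrix

/-- The nontrivial cuts of `V_n = Fin n`: subsets `C` with `∅ ⊊ C ⊊ V_n`;
there are `2^n − 2` of them. -/
abbrev Cuts (n : ℕ) := {C : Finset (Fin n) // C ≠ ∅ ∧ C ≠ Finset.univ}

/-- The full cut-matrix `S`: rows indexed by the 2-element subsets `{i,j}` of `V_n`,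
columns indexed by the nontrivial cuts `C`, with entry `δ_C(i,j)`, i.e. 1 iff
`|{i,j} ∩ C| = 1` (exactly one of `i, j` lies in `C`). -/
def fullCutMatrix (n : ℕ) : Matrix (Pairs n) (Cuts n) ℝ :=
  Matrix.of fun P C => if (P.1 ∩ C.1).card = 1 then 1 else 0

/-- Orthogonality of the characters `C ↦ (-1) ^ #(P ∩ C)` of the power set. -/
theorem sum_neg_one_pow_card_inter_mul {α : Type*} [Fintype α] [DecidableEq α]
    (P Q : Finset α) :
    ∑ C : Finset α, (-1 : ℝ) ^ (P ∩ C).card * (-1) ^ (Q ∩ C).card =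
      if P = Q then 2 ^ Fintype.card α else 0 := by
  have key (P C : Finset α) :
      (-1 : ℝ) ^ (P ∩ C).card = ∏ i ∈ C, if i ∈ P then -1 else 1 := by
    rw [Finset.prod_ite, Finset.prod_const, Finset.prod_const_one, mul_one,
      Finset.filter_mem_eq_inter, Finset.inter_comm]
  simp_rw [key, ← Finset.prod_mul_distrib]
  rw [← Finset.powerset_univ, ← Finset.prod_add_one]
  split_ifs with h
  · subst h
    rw [Finset.prod_congr rfl (g := fun _ => (2 : ℝ))
      (fun i _ => by split_ifs <;> norm_num)]
    simp
  · obtain ⟨i, hi⟩ : ∃ i, ¬(i ∈ P ↔ i ∈ Q) := by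
      simpa [Finset.ext_iff] using h
    refine Finset.prod_eq_zero (Finset.mem_univ i) ?_
    by_cases hP : i ∈ P <;> by_cases hQ : i ∈ Q <;> simp_all

theorem sum_neg_one_pow_card_inter {α : Type*} [Fintype α] [DecidableEq α]
    {P : Finset α} (hP : P ≠ ∅) : ∑ C : Finset α, (-1 : ℝ) ^ (P ∩ C).card = 0 := by
  simpa [hP] using sum_neg_one_pow_card_inter_mul P ∅

theorem ite_card_inter_eq_one {α : Type*} [DecidableEq α] {P : Finset α} (hP : P.card = 2)
    (C : Finset α) :
    (if (P ∩ C).card = 1 then (1 : ℝ) else 0) = (1 - (-1) ^ (P ∩ C).card) / 2 := by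
  have h : (P ∩ C).card ≤ 2 := hP ▸ Finset.card_le_card Finset.inter_subset_left
  interval_cases (P ∩ C).card <;> norm_num

/-- For `n ≥ 3` and `m = C(n,2)`, the full cut-matrix satisfies
`S·Sᵀ = 2^{n−2}·(I_m + J_m)`, where `J_m` is the all-ones matrix. -/
theorem fullCutMatrix_mul_transpose (n : ℕ) (hn : 3 ≤ n) :
    fullCutMatrix n * (fullCutMatrix n)ᵀ =
      (2 ^ (n - 2) : ℝ) • (1 + Matrix.of (fun _ _ : Pairs n => (1 : ℝ))) := by
  ext P Q
  have hP : P.1 ≠ ∅ := fun h => by simpa [h] using P.2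
  have hQ : Q.1 ≠ ∅ := fun h => by simpa [h] using Q.2
  have hsum : (fullCutMatrix n * (fullCutMatrix n)ᵀ) P Q =
      ∑ C : Finset (Fin n), (if (P.1 ∩ C).card = 1 then (1 : ℝ) else 0) *
        (if (Q.1 ∩ C).card = 1 then 1 else 0) := by
    rw [← Finset.sum_filter_of_ne (p := fun C => C ≠ ∅ ∧ C ≠ Finset.univ)]
    · rw [Finset.sum_subtype _ (p := fun C => C ≠ ∅ ∧ C ≠ Finset.univ) (by simp)]
      rfl
    · rintro C - hC
      constructor <;> rintro rfl <;> simp [P.2] at hC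
  have hexp (C : Finset (Fin n)) :
      (if (P.1 ∩ C).card = 1 then (1 : ℝ) else 0) * (if (Q.1 ∩ C).card = 1 then 1 else 0) =
        (1 - (-1) ^ (P.1 ∩ C).card - (-1) ^ (Q.1 ∩ C).card +
          (-1) ^ (P.1 ∩ C).card * (-1) ^ (Q.1 ∩ C).card) / 4 := by
    rw [ite_card_inter_eq_one P.2, ite_card_inter_eq_one Q.2]
    ring
  have hpow : (2 : ℝ) ^ n = 2 ^ (n - 2) * 4 := by
    rw [show (4 : ℝ) = 2 ^ 2 by norm_num, ← pow_add, Nat.sub_add_cancel (by omega)]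
  rw [hsum, Finset.sum_congr rfl fun C _ => hexp C, ← Finset.sum_div, Finset.sum_add_distrib,
    Finset.sum_sub_distrib, Finset.sum_sub_distrib, sum_neg_one_pow_card_inter hP,
    sum_neg_one_pow_card_inter hQ, sum_neg_one_pow_card_inter_mul]
  by_cases h : P = Q
  · subst h
    simp [hpow]
    ring
  · simp [hpow, h, Subtype.ext_iff.not.mp h]
end

section
/- For n ≥ 5, the full cut-matrix S has rank C(n,2), and consequently its kernel (null space) has dimension 2^n − 2 − C(n,2). -/
open Finset Matrix

/-- The cut semimetrics of `{i}`, `{j}` and `{i, j}` combine to twice the indicator of `{i, j}`. -/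
lemma cut_singleton_add_cut_singleton_sub_cut_pair {α : Type*} [DecidableEq α] {i j : α}
    (hij : i ≠ j) {P : Finset α} (hP : P.card = 2) :
    ((if (P ∩ {i}).card = 1 then 1 else 0) + (if (P ∩ {j}).card = 1 then 1 else 0) -
      (if (P ∩ {i, j}).card = 1 then 1 else 0) : ℝ) = if P = {i, j} then 2 else 0 := by
  have hPij : P = {i, j} ↔ i ∈ P ∧ j ∈ P := by
    refine ⟨by rintro rfl; simp, fun h => (Finset.eq_of_subset_of_card_le ?_ ?_).symm⟩
    · simp [Finset.insert_subset_iff, h]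
    · rw [hP, Finset.card_pair hij]
  have hpair : P ∩ {i, j} = (P ∩ {i}) ∪ (P ∩ {j}) := by
    rw [← Finset.inter_union_distrib_left, Finset.insert_eq]
  by_cases hi : i ∈ P <;> by_cases hj : j ∈ P <;>
    simp [hPij, hpair, hi, hj, Finset.inter_singleton_of_mem, Finset.inter_singleton_of_notMem,
      Finset.card_pair hij]
  norm_num

lemma linearIndependent_row_fullCutMatrix {n : ℕ} (hn : 3 ≤ n) :
    LinearIndependent ℝ (fullCutMatrix n).row := by
  rw [Fintype.linearIndependent_iff]
  rintro x hx ⟨Q, hQ⟩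
  obtain ⟨i, j, hij, rfl⟩ := Finset.card_eq_two.mp hQ
  have hcut (C : Finset (Fin n)) (hC : C ≠ ∅) (hcard : C.card ≤ 2) :
      ∑ P, x P * (if (P.1 ∩ C).card = 1 then 1 else 0) = 0 := by
    have hC' : C ≠ Finset.univ := by
      rintro rfl
      simp at hcard
      omega
    simpa [fullCutMatrix, Matrix.row] using congrFun hx ⟨C, hC, hC'⟩
  have hsum : ∑ P : Pairs n, x P * (if P.1 = {i, j} then 2 else 0) = 0 := by
    simp_rw [← fun P : Pairs n => cut_singleton_add_cut_singleton_sub_cut_pair hij P.2,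
      mul_sub, mul_add, Finset.sum_sub_distrib, Finset.sum_add_distrib]
    rw [hcut {i} (by simp) (by simp), hcut {j} (by simp) (by simp), hcut {i, j} (by simp) hQ.le]
    norm_num
  rw [Finset.sum_eq_single ⟨{i, j}, hQ⟩ (fun P _ hP => by
    rw [if_neg fun h => hP (Subtype.ext h), mul_zero]) (by simp)] at hsum
  simpa using hsum

lemma card_pairs (n : ℕ) : Fintype.card (Pairs n) = n.choose 2 := by
  simp

lemma card_cuts {n : ℕ} (hn : n ≠ 0) : Fintype.card (Cuts n) = 2 ^ n - 2 := by
  have : NeZero n := ⟨hn⟩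
  have hfilter : (Finset.univ.filter fun C : Finset (Fin n) => C ≠ ∅ ∧ C ≠ Finset.univ) =
      ({∅, Finset.univ} : Finset (Finset (Fin n)))ᶜ := by
    ext C
    simp
  rw [Fintype.card_subtype, hfilter, Finset.card_compl,
    Finset.card_pair Finset.univ_nonempty.ne_empty.symm]
  simp

/-- For `n ≥ 5`, the full cut-matrix `S` has rank `C(n,2)`, and
consequently its kernel has dimension `2^n − 2 − C(n,2)`. -/
theorem fullCutMatrix_rank_and_kernel_dim (n : ℕ) (hn : 5 ≤ n) :
    (fullCutMatrix n).rank = n.choose 2 ∧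
    Module.finrank ℝ (LinearMap.ker (fullCutMatrix n).mulVecLin) =
      2 ^ n - 2 - n.choose 2 := by
  have hrank : (fullCutMatrix n).rank = n.choose 2 := by
    rw [(linearIndependent_row_fullCutMatrix (by omega)).rank_matrix, card_pairs]
  refine ⟨hrank, ?_⟩
  have hnullity := (fullCutMatrix n).mulVecLin.finrank_range_add_finrank_ker
  rw [Module.finrank_fintype_fun_eq_card, card_cuts (by omega)] at hnullity
  change (fullCutMatrix n).rank + _ = _ at hnullity
  omega
end

section
/- Let n ≥ 5 and let T ⊆ V_n be a subset with |T| ≥ 3. Then the vector ψ_T lies in the kernel of the full cut-matrix S, i.e. S·ψ_T = 0. -/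
open Finset Matrix

/-- The alternating-sum vector `ψ_T = ∑_{C ⊆ T, C nontrivial} (−1)^{|C|}·e_C`
in `ℝ^{2^n−2}` (coordinates indexed by the nontrivial cuts). -/
def psiVec {n : ℕ} (T : Finset (Fin n)) : Cuts n → ℝ :=
  fun C => if C.1 ⊆ T then (-1 : ℝ) ^ C.1.card else 0

/-- A signed sum over all finite sets vanishes when the unsigned summand does not depend on
whether some fixed `x` belongs to the set. -/
lemma sum_neg_one_pow_card_mul_eq_zero {α R : Type*} [Fintype α] [DecidableEq α] [CommRing R]
    (x : α) (g : Finset α → R) (hg : ∀ C, x ∉ C → g (insert x C) = g C) :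
    ∑ C : Finset α, (-1 : R) ^ C.card * g C = 0 := by
  have hsplit := Finset.sum_powerset_insert (notMem_erase x univ)
    (fun C : Finset α => (-1 : R) ^ C.card * g C)
  rw [insert_erase (mem_univ x), powerset_univ] at hsplit
  rw [hsplit, ← sum_add_distrib]
  refine sum_eq_zero fun C hC => ?_
  have hx : x ∉ C := fun h => notMem_erase x univ (mem_powerset.1 hC h)
  rw [card_insert_of_notMem hx, hg C hx]
  ring

/-- For `n ≥ 5` and any subset `T ⊆ V_n` with `|T| ≥ 3`, the vector
`ψ_T` lies in the kernel of the full cut-matrix: `S·ψ_T = 0`. -/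
theorem psi_vector_in_kernel (n : ℕ) (hn : 5 ≤ n) (T : Finset (Fin n))
    (hT : 3 ≤ T.card) :
    (fullCutMatrix n).mulVec (psiVec T) = 0 := by
  funext P
  obtain ⟨x, hxT, hxP⟩ : ∃ x ∈ T, x ∉ P.1 :=
    exists_mem_notMem_of_card_lt_card (by rw [P.2]; omega)
  have key := sum_neg_one_pow_card_mul_eq_zero (R := ℝ) x
    (fun C => if (P.1 ∩ C).card = 1 ∧ C ⊆ T then 1 else 0) (fun C _ => by
      simp only [inter_insert_of_notMem hxP, insert_subset_iff, hxT, true_and])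
  rw [← sum_filter_of_ne (p := fun C => C ≠ ∅ ∧ C ≠ univ) (fun C _ hC => by
    refine ⟨?_, ?_⟩ <;> rintro rfl <;> simp [P.2] at hC),
    sum_subtype (p := fun C => C ≠ ∅ ∧ C ≠ univ) _ (fun C => by simp)] at key
  rw [Pi.zero_apply, ← key, mulVec, dotProduct]
  refine sum_congr rfl fun C _ => ?_
  simp only [fullCutMatrix, psiVec, of_apply, ite_and]
  split_ifs <;> simp
end

section
/- Let n ≥ 3 and consider the 2^n − 1 vectors ψ_T ∈ ℝ^{2^n − 2} indexed by the nonempty subsets T ⊆ V_n. Then for every nonempty subset T₀ ⊆ V_n, the family {ψ_T : T ⊆ V_n nonempty, T ≠ T₀} of 2^n − 2 vectors is linearly independent, and hence a basis of ℝ^{2^n − 2}. In particular, the family {ψ_T : T ⊆ V_n, |T| ≥ 3} is linearly independent. -/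
open Finset Matrix

/-- The alternating sum over an interval `[A, B]` of finsets vanishes unless `A = B`. -/
lemma sum_Icc_neg_one_pow_card {α : Type*} [DecidableEq α] {A B : Finset α} (h : A ⊆ B) :
    ∑ C ∈ Finset.Icc A B, (-1 : ℝ) ^ C.card = if A = B then (-1 : ℝ) ^ A.card else 0 := by
  rw [Finset.Icc_eq_image_powerset h, Finset.sum_image]
  · have hcard : ∀ D ∈ (B \ A).powerset,
        (-1 : ℝ) ^ (A ∪ D).card = (-1) ^ A.card * (-1) ^ D.card := fun D hD => by
      rw [Finset.card_union_of_disjoint, pow_add]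
      exact Finset.disjoint_sdiff.mono_right (Finset.mem_powerset.1 hD)
    have hsum : ∑ D ∈ (B \ A).powerset, (-1 : ℝ) ^ D.card = if B \ A = ∅ then 1 else 0 :=
      mod_cast Finset.sum_powerset_neg_one_pow_card (x := B \ A)
    have hiff : B \ A = ∅ ↔ A = B := by
      rw [Finset.sdiff_eq_empty_iff_subset]
      exact ⟨fun h' => h.antisymm h', fun h' => h'.ge⟩
    rw [Finset.sum_congr rfl hcard, ← Finset.mul_sum, hsum]
    simp only [hiff, mul_ite, mul_one, mul_zero]
  · intro D hD E hE hDE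
    have hD' := Finset.disjoint_sdiff.mono_right (Finset.mem_powerset.1 hD)
    have hE' := Finset.disjoint_sdiff.mono_right (Finset.mem_powerset.1 hE)
    rw [← Finset.union_sdiff_cancel_left hD', ← Finset.union_sdiff_cancel_left hE']
    exact congrArg (· \ A) hDE

/-- Möbius inversion over the supersets of `A`. -/
lemma sum_superset_neg_one_pow_card_mul {α : Type*} [DecidableEq α] [Fintype α]
    (a : Finset α → ℝ) (A : Finset α) :
    ∑ C with A ⊆ C, (-1 : ℝ) ^ C.card * ∑ T with C ⊆ T, a T = (-1) ^ A.card * a A := by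
  simp_rw [Finset.mul_sum]
  rw [Finset.sum_comm' (t' := Finset.univ.filter (A ⊆ ·)) (s' := fun T => Finset.Icc A T)]
  · have hinner : ∀ T ∈ Finset.univ.filter (A ⊆ ·),
        ∑ C ∈ Finset.Icc A T, (-1 : ℝ) ^ C.card * a T
          = if A = T then (-1) ^ A.card * a A else 0 := fun T hT => by
      rw [← Finset.sum_mul, sum_Icc_neg_one_pow_card (Finset.mem_filter.1 hT).2]
      split_ifs with h <;> simp [h]
    rw [Finset.sum_congr rfl hinner]
    simp
  · intro C T
    simp only [Finset.mem_filter, Finset.mem_univ, true_and, Finset.mem_Icc]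
    exact ⟨fun h => ⟨h, h.1.trans h.2⟩, fun h => h.1⟩

/-- A linear relation between the vectors `ψ_T` has coefficients `a_A` equal, up to sign, to
`a_V` for every nonempty `A`. -/
lemma neg_one_pow_card_mul_eq_of_sum_smul_psiVec_eq_zero {n : ℕ} {a : Finset (Fin n) → ℝ}
    (ha : ∑ T, a T • psiVec T = 0) {A : Finset (Fin n)} (hA : A.Nonempty) :
    (-1) ^ A.card * a A = (-1) ^ n * a Finset.univ := by
  have hzero : ∀ C : Finset (Fin n), C.Nonempty → C ≠ Finset.univ →
      (-1 : ℝ) ^ C.card * ∑ T with C ⊆ T, a T = 0 := fun C hC hC' => by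
    have h := congrFun ha ⟨C, hC.ne_empty, hC'⟩
    simp only [Finset.sum_apply, Pi.smul_apply, psiVec, smul_eq_mul, Pi.zero_apply, mul_ite,
      mul_zero] at h
    rw [← Finset.sum_filter, ← Finset.sum_mul, mul_comm] at h
    exact h
  rw [← sum_superset_neg_one_pow_card_mul a A, Finset.sum_eq_single Finset.univ]
  · simp [Finset.univ_subset_iff, Finset.filter_eq']
  · exact fun C hC hC' => hzero C (hA.mono (Finset.mem_filter.1 hC).2) hC'
  · simp

lemma linearIndepOn_psiVec {n : ℕ} {T₀ : Finset (Fin n)} (hT₀ : T₀.Nonempty) :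
    LinearIndepOn ℝ psiVec {T : Finset (Fin n) | T.Nonempty ∧ T ≠ T₀} := by
  rw [linearIndepOn_iff'']
  intro t a ht hat hsum A hAt
  have hsum' : ∑ T, a T • psiVec T = 0 := by
    rw [← hsum]
    refine (Finset.sum_subset (Finset.subset_univ t) fun T _ hT => ?_).symm
    rw [hat T hT, zero_smul]
  have h₀ := neg_one_pow_card_mul_eq_of_sum_smul_psiVec_eq_zero hsum' hT₀
  rw [hat T₀ fun h => (ht h).2 rfl, mul_zero] at h₀
  have h := neg_one_pow_card_mul_eq_of_sum_smul_psiVec_eq_zero hsum' (ht hAt).1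
  simpa [← h₀] using h

lemma card_ne_and_ne {α : Type*} [Fintype α] [DecidableEq α] {x y : α} (h : x ≠ y) :
    Fintype.card {z : α // z ≠ x ∧ z ≠ y} = Fintype.card α - 2 := by
  rw [Fintype.card_subtype, ← Finset.card_pair h, ← Finset.card_compl]
  congr 1
  ext z
  simp

/-- For `n ≥ 3`, consider the `2^n − 1` vectors `ψ_T ∈ ℝ^{2^n−2}`
indexed by the nonempty subsets `T ⊆ V_n`.  For every nonempty `T₀ ⊆ V_n`, the family
obtained by removing `ψ_{T₀}` is linearly independent, hence a basis of `ℝ^{2^n−2}`.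
In particular, the family `{ψ_T : |T| ≥ 3}` is linearly independent. -/
theorem psi_vectors_remove_one_basis (n : ℕ) (hn : 3 ≤ n) :
    (∀ T₀ : Finset (Fin n), T₀.Nonempty →
      LinearIndependent ℝ
        (fun T : {T : Finset (Fin n) // T.Nonempty ∧ T ≠ T₀} => psiVec T.1) ∧
      Submodule.span ℝ
          (Set.range
            (fun T : {T : Finset (Fin n) // T.Nonempty ∧ T ≠ T₀} => psiVec T.1)) = ⊤) ∧
    LinearIndependent ℝ
      (fun T : {T : Finset (Fin n) // 3 ≤ T.card} => psiVec T.1) := by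
  refine ⟨fun T₀ hT₀ => ?_, ?_⟩
  · have hli : LinearIndependent ℝ
        (fun T : {T : Finset (Fin n) // T.Nonempty ∧ T ≠ T₀} => psiVec T.1) :=
      linearIndepOn_psiVec hT₀
    refine ⟨hli, hli.span_eq_top_of_card_eq_finrank' ?_⟩
    have : Nonempty (Fin n) := ⟨⟨0, by omega⟩⟩
    rw [Module.finrank_fintype_fun_eq_card,
      card_ne_and_ne (Finset.univ_nonempty (α := Fin n)).ne_empty.symm,
      ← card_ne_and_ne hT₀.ne_empty.symm]
    simp only [Finset.nonempty_iff_ne_empty]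
  · refine (linearIndepOn_psiVec (Finset.singleton_nonempty (⟨0, by omega⟩ : Fin n))).mono
      fun T (hT : 3 ≤ T.card) => ⟨Finset.card_pos.1 (by omega), ?_⟩
    rintro rfl
    simp at hT
end
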